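/- There does not exist any function g : ℕ → ℕ such that for every digraph J and every directed topological minor H of J, dbw(H) ≤ g(dbw(J)). In particular there is a family of digraphs of directed branch-width at most 3 having directed topological minors of arbitrarily large directed branch-width. -/

import Mathlib

open scoped Classical

/-! ### Basic digraph notions -/

/-- The set of directed edges of a digraph, as ordered pairs. -/
def Digraph.edgeSet' {V : Type} (D : Digraph V) : Set (V × V) := {p | D.Adj p.1 p.2}

/-- The underlying undirected graph of a digraph. -/
def underlying {V : Type} (D : Digraph V) : SimpleGraph V := SimpleGraph.fromRel D.Adj

/-- A source: a vertex with no incoming edge. -/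
def IsSource {V : Type} (D : Digraph V) (x : V) : Prop := ∀ w, ¬ D.Adj w x

/-- A sink: a vertex with no outgoing edge. -/
def IsSink {V : Type} (D : Digraph V) (x : V) : Prop := ∀ z, ¬ D.Adj x z

/-- Delete the edge `x→y` from `D`. -/
def Digraph.deleteEdge {V : Type} (D : Digraph V) (x y : V) : Digraph V where
  Adj a b := D.Adj a b ∧ ¬(a = x ∧ b = y)

/-! ### Separators and directed branch-width -/

/-- Directed vertex separator of the edge partition `(E(D) \ X, X)`: vertices `y` admitting
an edge `x→y` of `E(D) \ X` and an edge `y→z` of `X`. -/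
def dirSep {V : Type} (D : Digraph V) (X : Set (V × V)) : Set V :=
  {y | ∃ x z : V, D.Adj x y ∧ (x, y) ∉ X ∧ D.Adj y z ∧ (y, z) ∈ X}

/-- The bidirected separator of the edge partition `(E(D) \ X, X)`: the union of the
directed vertex separators of `(E(D) \ X, X)` and of `(X, E(D) \ X)`. -/
def biSep {V : Type} (D : Digraph V) (X : Set (V × V)) : Set V :=
  dirSep D X ∪ dirSep D (D.edgeSet' \ X)

/-- Leaves of a graph: vertices with at most one neighbour. -/
def leaves {T : Type} (G : SimpleGraph T) : Set T := {t | (G.neighborSet t).Subsingleton}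

/-- The vertices on the `b`-side of the edge `ab` of a tree: those reachable from `b`
after deleting the edge `ab`. -/
def side {T : Type} (G : SimpleGraph T) (a b : T) : Set T :=
  {t | (G.deleteEdges {s(a, b)}).Reachable b t}

/-- Maximum degree at most three. -/
def maxDegLE3 {T : Type} (G : SimpleGraph T) : Prop := ∀ t, (G.neighborSet t).ncard ≤ 3

/-- `D` has a directed branch decomposition of width at most `k`: a tree of maximum degree
three whose leaves are in bijection with `E(D)`, every edge of which induces an edge
partition whose bidirected separator has at most `k` elements. -/
def dbwLE {V : Type} (D : Digraph V) (k : ℕ) : Prop :=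
  ∃ (m : ℕ) (G : SimpleGraph (Fin m)) (β : Fin m → V × V),
    G.IsTree ∧ maxDegLE3 G ∧ Set.BijOn β (leaves G) D.edgeSet' ∧
    ∀ a b : Fin m, G.Adj a b →
      (biSep D (β '' (leaves G ∩ side G a b))).ncard ≤ k

/-- Directed branch-width. -/
noncomputable def dbw {V : Type} (D : Digraph V) : ℕ := sInf {k | dbwLE D k}

/-! ### Directed line graph and bi-cut-rank-width -/

/-- The directed line graph of `D`: vertices are the edges of `D`, with an edge `e→f`
whenever `e` ends where `f` starts. -/
def dirLineGraph {V : Type} (D : Digraph V) : Digraph {e : V × V // D.Adj e.1 e.2} where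
  Adj e f := e.val.2 = f.val.1

/-- The GF(2) adjacency matrix of a digraph, as a function. -/
noncomputable def adjFun {W : Type} (H : Digraph W) (a b : W) : ZMod 2 :=
  if H.Adj a b then 1 else 0

/-- The rank over GF(2) of the submatrix `M[A, B]` of the adjacency matrix of `H`:
the dimension of the span of the rows indexed by `A`, restricted to the columns `B`. -/
noncomputable def cutrk {W : Type} (H : Digraph W) (A B : Set W) : ℕ :=
  Module.finrank (ZMod 2)
    (Submodule.span (ZMod 2) ((fun a : W => fun b : B => adjFun H a (b : W)) '' A))

/-- `H` has a bi-cut-rank decomposition of width at most `k`: a tree of maximum degree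
three whose leaves are in bijection with `V(H)`, each edge of which induces a vertex
partition `(V(H) \ X, X)` with `rk M[V(H) \ X, X] + rk M[X, V(H) \ X] ≤ k`. -/
def bcrkLE {W : Type} (H : Digraph W) (k : ℕ) : Prop :=
  ∃ (m : ℕ) (G : SimpleGraph (Fin m)) (β : Fin m → W),
    G.IsTree ∧ maxDegLE3 G ∧ Set.BijOn β (leaves G) Set.univ ∧
    ∀ a b : Fin m, G.Adj a b →
      cutrk H (β '' (leaves G ∩ side G a b))ᶜ (β '' (leaves G ∩ side G a b)) +
        cutrk H (β '' (leaves G ∩ side G a b)) (β '' (leaves G ∩ side G a b))ᶜ ≤ k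

/-- Bi-cut-rank-width. -/
noncomputable def bcrk {W : Type} (H : Digraph W) : ℕ := sInf {k | bcrkLE H k}

/-! ### Undirected branch-width -/

/-- The vertices of `G` incident both with an edge outside `X` and with an edge in `X`. -/
def usep {V : Type} (G : SimpleGraph V) (X : Set (Sym2 V)) : Set V :=
  {v | (∃ e ∈ G.edgeSet \ X, v ∈ e) ∧ (∃ e ∈ X, v ∈ e)}

/-- `G` has an (undirected) branch decomposition of width at most `k`. -/
def bwLE {V : Type} (G : SimpleGraph V) (k : ℕ) : Prop :=
  ∃ (m : ℕ) (T : SimpleGraph (Fin m)) (β : Fin m → Sym2 V),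
    T.IsTree ∧ maxDegLE3 T ∧ Set.BijOn β (leaves T) G.edgeSet ∧
    ∀ a b : Fin m, T.Adj a b →
      (usep G (β '' (leaves T ∩ side T a b))).ncard ≤ k

/-- Branch-width of an undirected graph. -/
noncomputable def bw {V : Type} (G : SimpleGraph V) : ℕ := sInf {k | bwLE G k}

/-! ### Source-sink identification -/

/-- Identify the vertex `y` into the vertex `x`; the vertex `y` is kept, but becomes
an isolated vertex. -/
def identify {V : Type} (D : Digraph V) (x y : V) : Digraph V where
  Adj a b := a ≠ y ∧ b ≠ y ∧
    ∃ a' b', (if a' = y then x else a') = a ∧ (if b' = y then x else b') = b ∧ D.Adj a' b'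

/-- One identification of a pair of distinct source/sink-identifiable vertices. -/
def identStep {V : Type} (D D' : Digraph V) : Prop :=
  ∃ x y, x ≠ y ∧
    ((IsSource D x ∧ IsSource D y) ∨ (IsSink D x ∧ IsSink D y)) ∧
    D' = identify D x y

/-! ### Minors -/

/-- Contract the edge `x→y`: the two endpoints are merged into `x`, while `y` is
kept as an isolated vertex. -/
def contractEdge {V : Type} (D : Digraph V) (x y : V) : Digraph V where
  Adj a b := a ≠ y ∧ b ≠ y ∧
    ∃ a' b', (if a' = y then x else a') = a ∧ (if b' = y then x else b') = b ∧
      D.Adj a' b' ∧ ¬(a' = x ∧ b' = y)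

/-- The number of edges incident with `v`. -/
noncomputable def degree' {V : Type} (D : Digraph V) (v : V) : ℕ :=
  {e ∈ D.edgeSet' | v = e.1 ∨ v = e.2}.ncard

/-- The vertices incident with at least three edges. -/
def V3 {V : Type} (D : Digraph V) : Set V := {v | 3 ≤ degree' D v}

/-- The edge `x→y` is 2-contractible. -/
def TwoContractible {V : Type} (D : Digraph V) (x y : V) : Prop :=
  D.Adj x y ∧ ¬(({x, y} : Set V) ⊆ V3 D) ∧
  (D.Adj y x ∨
    ¬∃ w z, w ∈ V3 D ∧ z ∈ V3 D ∧
      Relation.ReflTransGen (D.deleteEdge x y).Adj x w ∧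
      Relation.ReflTransGen (D.deleteEdge x y).Adj z y)

/-- One contraction of a 2-contractible edge. -/
def topStep {V : Type} (D D' : Digraph V) : Prop :=
  ∃ x y, TwoContractible D x y ∧ D' = contractEdge D x y

/-- `H` is a directed topological minor of `D`: it is obtained from a subgraph of `D` by a
sequence of contractions of 2-contractible edges. -/
def DirTopMinor {V : Type} (H D : Digraph V) : Prop :=
  ∃ D₀ : Digraph V, (∀ ⦃a b⦄, D₀.Adj a b → D.Adj a b) ∧ Relation.ReflTransGen topStep D₀ H

/-- The edge `x→y` is a butterfly edge: `x` has out-degree 1 and `y` has in-degree 1. -/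
def ButterflyEdge {V : Type} (D : Digraph V) (x y : V) : Prop :=
  D.Adj x y ∧ (∀ z, D.Adj x z → z = y) ∧ (∀ w, D.Adj w y → w = x)

/-- One contraction of a butterfly edge. -/
def butterflyStep {V : Type} (D D' : Digraph V) : Prop :=
  ∃ x y, ButterflyEdge D x y ∧ D' = contractEdge D x y

/-- `H` is a butterfly minor of `D`: it is obtained from a subgraph of `D` by a sequence of
contractions of butterfly edges. -/
def ButterflyMinor {V : Type} (H D : Digraph V) : Prop :=
  ∃ D₀ : Digraph V, (∀ ⦃a b⦄, D₀.Adj a b → D.Adj a b) ∧ Relation.ReflTransGen butterflyStep D₀ H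

/-! ### Directed cuts and consistency -/

/-- Directed order of a vertex partition `(V(D) \ Z, Z)`: the number of edges starting
outside `Z` and ending in `Z`. -/
noncomputable def dirOrder {V : Type} (D : Digraph V) (Z : Set V) : ℕ :=
  {e : V × V | D.Adj e.1 e.2 ∧ e.1 ∉ Z ∧ e.2 ∈ Z}.ncard

/-- `(A, B)` is `(lA, lB)`-consistent: vertices of `A` with the same `lA`-label have the same
out-neighbours in `B`, and vertices of `B` with the same `lB`-label have the same
in-neighbours in `A`. -/
def Consistent {W S : Type} (H : Digraph W) (A B : Set W) (lA lB : W → S) : Prop :=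
  (∀ a₁ ∈ A, ∀ a₂ ∈ A, lA a₁ = lA a₂ → ∀ b ∈ B, (H.Adj a₁ b ↔ H.Adj a₂ b)) ∧
  (∀ b₁ ∈ B, ∀ b₂ ∈ B, lB b₁ = lB b₂ → ∀ a ∈ A, (H.Adj a b₁ ↔ H.Adj a b₂))


inductive Vx (N : ℕ) : Type
  | L (i : Fin N) | A (i : Fin N) | U (i : Fin N) | R (i : Fin N) | B (i : Fin N) | C (i : Fin N)

open Vx

/-- Injective encoding of the vertices. -/
def exCode {N : ℕ} : Vx N → Fin 6 × Fin N
  | L i => (0, i)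
  | A i => (1, i)
  | U i => (2, i)
  | R i => (3, i)
  | B i => (4, i)
  | C i => (5, i)

lemma exCode_injective {N : ℕ} : Function.Injective (exCode (N := N)) := by
  intro a b h
  cases a <;> cases b <;> simp_all [exCode]

noncomputable instance exFintype {N : ℕ} : Fintype (Vx N) :=
  Fintype.ofInjective exCode exCode_injective

/-- The edge relation after contracting the `A i`, `i ∈ S`, and the `R j`, `j ∈ T`. -/
def exAdj {N : ℕ} (S T : Finset (Fin N)) : Vx N → Vx N → Prop
  | L _, R j => j ∉ T
  | L _, B j => j ∈ T
  | L i, A k => i = k ∧ i ∉ S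
  | U i, A k => i = k ∧ i ∉ S
  | U i, L k => i = k ∧ i ∈ S
  | B i, R k => i = k ∧ i ∉ T
  | B i, C k => i = k
  | _, _ => False

def exD {N : ℕ} (S T : Finset (Fin N)) : Digraph (Vx N) where
  Adj := exAdj S T

lemma exPair_le {α : Type} (e f : α) : ({e, f} : Set α).ncard ≤ 2 := by
  refine (Set.ncard_insert_le _ _).trans ?_
  rw [Set.ncard_singleton]

lemma not_V3_of_subset {V : Type} (D : Digraph V) (v : V) (e f : V × V)
    (h : ∀ a b, D.Adj a b → (v = a ∨ v = b) → (a, b) = e ∨ (a, b) = f) : v ∉ V3 D := by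
  have h1 : degree' D v ≤ ({e, f} : Set (V × V)).ncard := by
    apply Set.ncard_le_ncard
    · rintro ⟨a, b⟩ ⟨hab, hv⟩
      exact h a b hab hv
    · exact Set.toFinite _
  have h2 := exPair_le e f
  simp only [V3, Set.mem_ofPred_eq]
  omega

lemma step_S {N : ℕ} (S T : Finset (Fin N)) (i : Fin N) (hi : i ∉ S) :
    topStep (exD S T) (exD (insert i S) T) := by
  have hA : A i ∉ V3 (exD S T) := by
    apply not_V3_of_subset _ _ (L i, A i) (U i, A i)
    rintro (a|a|a|a|a|a) (b|b|b|b|b|b) h1 h2 <;> simp_all [exD, exAdj]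
  have hU : U i ∉ V3 (exD S T) := by
    apply not_V3_of_subset _ _ (U i, A i) (U i, A i)
    clear hA
    rintro (a|a|a|a|a|a) (b|b|b|b|b|b) h1 h2 <;> simp_all [exD, exAdj]
    all_goals grind
  refine ⟨L i, A i, ⟨by simp [exD, exAdj, hi], fun h => hA (h (by simp)), Or.inr ?_⟩, ?_⟩
  · rintro ⟨w, z, _, hz, _, hr⟩
    have key : ∀ y, Relation.ReflTransGen ((exD S T).deleteEdge (L i) (A i)).Adj z y →
        (y = A i ∨ y = U i) → z = A i ∨ z = U i := by
      intro y hy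
      induction hy with
      | refl => exact id
      | @tail b c _ hbc ih =>
        intro hc
        apply ih
        obtain ⟨h1, h2⟩ := hbc
        rcases hc with rfl | rfl <;> cases b <;> simp_all [exD, exAdj]
    rcases key _ hr (Or.inl rfl) with rfl | rfl
    · exact hA hz
    · exact hU hz
  · ext a b
    simp only [exD, contractEdge]
    constructor
    · intro h
      refine ⟨?_, ?_, ?_⟩
      · rintro rfl; cases b <;> simp_all [exAdj]
      · rintro rfl; cases a <;> simp_all [exAdj] <;> grind
      · by_cases hc : a = U i ∧ b = L i
        · obtain ⟨rfl, rfl⟩ := hc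
          exact ⟨U i, A i, by simp [exAdj, hi]⟩
        · refine ⟨a, b, ?_⟩
          cases a <;> cases b <;> simp_all [exAdj] <;> grind
    · rintro ⟨h1, h2, a', b', rfl, rfl, h3, h4⟩
      cases a' <;> cases b' <;> simp_all [exAdj] <;> grind [exAdj]

lemma step_T {N : ℕ} (S T : Finset (Fin N)) (i : Fin N) (hi : i ∉ T) :
    topStep (exD S T) (exD S (insert i T)) := by
  have hB : B i ∉ V3 (exD S T) := by
    apply not_V3_of_subset _ _ (B i, R i) (B i, C i)
    rintro (a|a|a|a|a|a) (b|b|b|b|b|b) h1 h2 <;> simp_all [exD, exAdj]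
  have hC : C i ∉ V3 (exD S T) := by
    apply not_V3_of_subset _ _ (B i, C i) (B i, C i)
    rintro (a|a|a|a|a|a) (b|b|b|b|b|b) h1 h2 <;> simp_all [exD, exAdj]
  refine ⟨B i, R i, ⟨by simp [exD, exAdj, hi], fun h => hB (h (by simp)), Or.inr ?_⟩, ?_⟩
  · rintro ⟨w, z, hw, _, hr, _⟩
    have key : w = B i ∨ w = C i := by
      clear hw
      induction hr with
      | refl => exact Or.inl rfl
      | @tail b c _ hbc ih =>
        obtain ⟨h1, h2⟩ := hbc
        rcases ih with rfl | rfl <;> cases c <;> simp_all [exD, exAdj]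
    rcases key with rfl | rfl
    · exact hB hw
    · exact hC hw
  · ext a b
    simp only [exD, contractEdge]
    constructor
    · intro h
      refine ⟨?_, ?_, ?_⟩
      · rintro rfl; cases b <;> simp_all [exAdj]
      · rintro rfl; cases a <;> simp_all [exAdj] <;> grind
      · by_cases hc : b = B i
        · subst hc
          refine ⟨a, R i, ?_⟩
          cases a <;> simp_all [exAdj]
        · refine ⟨a, b, ?_⟩
          cases a <;> cases b <;> simp_all [exAdj] <;> grind
    · rintro ⟨h1, h2, a', b', rfl, rfl, h3, h4⟩
      cases a' <;> cases b' <;> simp_all [exAdj] <;> grind [exAdj]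

lemma exMinor (N : ℕ) : DirTopMinor (exD (Finset.univ : Finset (Fin N)) Finset.univ) (exD ∅ ∅) := by
  refine ⟨exD ∅ ∅, fun _ _ h => h, ?_⟩
  have h1 : ∀ S : Finset (Fin N), Relation.ReflTransGen topStep (exD ∅ ∅) (exD S ∅) := by
    intro S
    induction S using Finset.induction_on with
    | empty => exact .refl
    | insert i S hi ih => exact ih.tail (step_S S _ i hi)
  have h2 : ∀ T : Finset (Fin N),
      Relation.ReflTransGen topStep (exD ∅ ∅) (exD Finset.univ T) := by
    intro T
    induction T using Finset.induction_on with
    | empty => exact h1 _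
    | insert i T hi ih => exact ih.tail (step_T _ T i hi)
  exact h2 _

lemma dbw_exJ (N : ℕ) : dbw (exD (∅ : Finset (Fin N)) ∅) = 0 := by
  have hs : ∀ X, biSep (exD (∅ : Finset (Fin N)) ∅) X = ∅ := by
    have h : ∀ X, dirSep (exD (∅ : Finset (Fin N)) ∅) X = ∅ := by
      intro X
      ext y
      simp only [dirSep, Set.mem_ofPred_eq, Set.mem_empty_iff_false, iff_false]
      rintro ⟨x, z, h1, _, h2, _⟩
      cases x <;> cases y <;> simp [exD, exAdj] at h1 <;> cases z <;> simp [exD, exAdj] at h2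
    intro X
    simp [biSep, h]
  unfold dbw
  rcases Set.eq_empty_or_nonempty {k | dbwLE (exD (∅ : Finset (Fin N)) ∅) k} with h | ⟨k, hk⟩
  · rw [h]; simp
  · obtain ⟨m, G, β, h1, h2, h3, h4⟩ := hk
    have : 0 ∈ {k | dbwLE (exD (∅ : Finset (Fin N)) ∅) k} :=
      ⟨m, G, β, h1, h2, h3, fun a b _ => by simp [hs]⟩
    exact Nat.sInf_eq_zero.2 (Or.inl this)

/-! ### Trees -/

lemma exists_mem_side {T : Type} (G : SimpleGraph T) (hG : G.Connected) (v t : T) (h : v ≠ t) :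
    ∃ w, G.Adj v w ∧ t ∈ side G v w := by
  obtain ⟨p, hp⟩ := hG.exists_isPath v t
  cases p with
  | nil => exact absurd rfl h
  | @cons _ w _ hadj q =>
    refine ⟨w, hadj, ?_⟩
    rw [SimpleGraph.Walk.cons_isPath_iff] at hp
    simp only [side, Set.mem_ofPred_eq]
    rw [SimpleGraph.reachable_deleteEdges_iff_exists_walk]
    exact ⟨q, fun hq => hp.2 (q.fst_mem_support_of_mem_edges hq)⟩

lemma side_disjoint {T : Type} (G : SimpleGraph T) (hG : G.IsAcyclic) (v w t : T)
    (h : G.Adj v w) (h1 : t ∈ side G v w) (h2 : t ∈ side G w v) : False := by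
  have hb := SimpleGraph.isAcyclic_iff_forall_adj_isBridge.1 hG h
  rw [SimpleGraph.isBridge_iff] at hb
  simp only [side, Set.mem_ofPred_eq] at h1 h2
  rw [Sym2.eq_swap] at h2
  exact hb (h2.trans h1.symm)

lemma exists_two_cycle {m : ℕ} (G : SimpleGraph (Fin m)) (hG : G.IsTree) (f : Fin m → Fin m)
    (hf : ∀ v, G.Adj v (f v)) : ∃ v, f (f v) = v := by
  have hc := hG.card_edgeFinset
  obtain ⟨v, _, w, _, hvw, he⟩ := Finset.exists_ne_map_eq_of_card_lt_of_maps_to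
    (s := (Finset.univ : Finset (Fin m))) (t := G.edgeFinset) (f := fun v => s(v, f v))
    (by rw [Finset.card_univ]; omega) (by intro v _; simpa using hf v)
  simp only [Sym2.eq_iff] at he
  refine ⟨v, ?_⟩
  rcases he with ⟨h1, _⟩ | ⟨h1, h2⟩
  · exact absurd h1 hvw
  · rw [h2, ← h1]

/-- heap-ordered binary tree with `N + 2` leaves. -/
def heapTree (N : ℕ) : SimpleGraph (Fin (2 * N + 3)) where
  Adj i j := (j : ℕ) = 2 * i + 1 ∨ (j : ℕ) = 2 * i + 2 ∨ (i : ℕ) = 2 * j + 1 ∨ (i : ℕ) = 2 * j + 2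
  symm := ⟨fun i j h => by tauto⟩
  loopless := ⟨fun i h => by omega⟩

lemma heapTree_connected (N : ℕ) : (heapTree N).Connected := by
  have h0 : ∀ n (hn : n < 2 * N + 3), (heapTree N).Reachable ⟨n, hn⟩ ⟨0, by omega⟩ := by
    intro n
    induction n using Nat.strong_induction_on with
    | _ n ih =>
      intro hn
      rcases Nat.eq_zero_or_pos n with rfl | hpos
      · exact SimpleGraph.Reachable.refl _
      · have h1 : (heapTree N).Adj ⟨n, hn⟩ ⟨(n - 1) / 2, by omega⟩ := by
          simp only [heapTree]; omega
        exact h1.reachable.trans (ih _ (by omega) _)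
  have : Nonempty (Fin (2 * N + 3)) := ⟨0⟩
  exact ⟨fun a b => (h0 a a.2).trans (h0 b b.2).symm⟩

lemma heapTree_isTree (N : ℕ) : (heapTree N).IsTree := by
  obtain ⟨T, hT, hTree⟩ := (heapTree_connected N).exists_isTree_le
  have hcard := hTree.card_edgeFinset
  have hle : (heapTree N).edgeFinset.card ≤ 2 * N + 2 := by
    have hsub : (heapTree N).edgeFinset ⊆ (Finset.univ : Finset (Fin (2 * N + 2))).image
        (fun i : Fin (2 * N + 2) => s((⟨i + 1, by omega⟩ : Fin (2 * N + 3)), ⟨i / 2, by omega⟩)) := by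
      intro e
      induction e using Sym2.ind with
      | _ a b =>
        intro h
        replace h : (heapTree N).Adj a b := SimpleGraph.mem_edgeFinset.1 h
        simp only [heapTree] at h
        simp only [Finset.mem_image, Finset.mem_univ, true_and, Sym2.eq_iff, Fin.ext_iff]
        rcases Nat.lt_or_ge (a : ℕ) b with hab | hab
        · exact ⟨⟨b - 1, by omega⟩, Or.inr ⟨by simp; omega, by simp; omega⟩⟩
        · exact ⟨⟨a - 1, by omega⟩, Or.inl ⟨by simp; omega, by simp; omega⟩⟩
    have := (Finset.card_le_card hsub).trans Finset.card_image_le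
    simpa using this
  have heq : T.edgeFinset = (heapTree N).edgeFinset := by
    apply Finset.eq_of_subset_of_card_le
    · simpa using hT
    · rw [Fintype.card_fin] at hcard; omega
  have : T = heapTree N := by simpa using heq
  exact this ▸ hTree

lemma heapTree_deg (N : ℕ) : maxDegLE3 (heapTree N) := by
  intro t
  have hsub : (heapTree N).neighborSet t ⊆
      ((fun i : Fin (2 * N + 3) => (i : ℕ)) ⁻¹' {((t : ℕ) - 1) / 2, 2 * (t : ℕ) + 1, 2 * (t : ℕ) + 2}) := by
    intro s hs
    simp only [SimpleGraph.mem_neighborSet, heapTree] at hs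
    simp only [Set.mem_preimage, Set.mem_insert_iff, Set.mem_singleton_iff]
    omega
  have h3 : ({((t : ℕ) - 1) / 2, 2 * (t : ℕ) + 1, 2 * (t : ℕ) + 2} : Set ℕ).ncard ≤ 3 := by
    refine (Set.ncard_insert_le _ _).trans ?_
    have := exPair_le (2 * (t : ℕ) + 1) (2 * (t : ℕ) + 2)
    omega
  refine le_trans ?_ h3
  apply Set.ncard_le_ncard_of_injOn (fun i : Fin (2 * N + 3) => (i : ℕ))
  · intro s hs; exact hsub hs
  · intro a _ b _ h; exact Fin.ext h

lemma heapTree_leaves (N : ℕ) : (leaves (heapTree N)).ncard = N + 2 := by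
  have h : leaves (heapTree N) =
      Set.range (fun i : Fin (N + 2) => (⟨N + 1 + i, by omega⟩ : Fin (2 * N + 3))) := by
    ext t
    simp only [leaves, Set.mem_ofPred_eq, Set.mem_range, Set.Subsingleton,
      SimpleGraph.mem_neighborSet, heapTree]
    constructor
    · intro h
      by_cases ht : N + 1 ≤ (t : ℕ)
      · exact ⟨⟨t - (N + 1), by omega⟩, Fin.ext (by simp; omega)⟩
      · have := @h ⟨2 * t + 1, by omega⟩ (by simp) ⟨2 * t + 2, by omega⟩ (by simp)
        simp at this
    · rintro ⟨i, rfl⟩ a ha b hb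
      apply Fin.ext
      simp only at ha hb
      omega
  rw [h, ← Set.image_univ, Set.ncard_image_of_injective]
  · simp
  · intro a b hab
    simp at hab
    exact Fin.ext hab

lemma exists_dbwLE {V : Type} [Finite V] (D : Digraph V) (h : 2 ≤ D.edgeSet'.ncard) :
    ∃ k, dbwLE D k := by
  obtain ⟨N, hN⟩ := Nat.exists_eq_add_of_le' h
  have : Nonempty (V × V) := by
    have : D.edgeSet'.Nonempty := Set.nonempty_of_ncard_ne_zero (by omega)
    exact ⟨this.some⟩
  obtain ⟨β, hβ⟩ := (Set.toFinite (leaves (heapTree N))).exists_bijOn_of_encard_eq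
    (t := D.edgeSet') (by
      rw [← (Set.toFinite (leaves (heapTree N))).cast_ncard_eq,
        ← (Set.toFinite D.edgeSet').cast_ncard_eq, heapTree_leaves, hN])
  exact ⟨Nat.card V, _, heapTree N, β, heapTree_isTree N, heapTree_deg N, hβ,
    fun a b _ => Set.ncard_le_card _⟩


/-! ### Lower bound -/

lemma exH_lower (N k : ℕ)
    (h : dbwLE (exD (Finset.univ : Finset (Fin N)) Finset.univ) k) : N ≤ 3 * k + 1 := by
  by_contra! hN
  obtain ⟨m, G, β, hT, hdeg, hβ, hw⟩ := h
  set D := exD (Finset.univ : Finset (Fin N)) Finset.univ with hD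
  have hUL : ∀ i, D.Adj (U i) (L i) := fun i => by simp [hD, exD, exAdj]
  have hLB : ∀ i j, D.Adj (L i) (B j) := fun i j => by simp [hD, exD, exAdj]
  have hBC : ∀ i, D.Adj (B i) (C i) := fun i => by simp [hD, exD, exAdj]
  let X : Fin m → Fin m → Set (Vx N × Vx N) := fun v w => β '' (leaves G ∩ side G v w)
  have hfin : Finite (Vx N) := inferInstance
  -- every node has a neighbour whose side contains all out-edges of some `L i`
  have hbig : ∀ v, ∃ w, G.Adj v w ∧ ∃ i, ∀ j, (L i, B j) ∈ X v w := by
    intro v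
    have hi : ∃ i, (U i, L i) ≠ β v ∧ ∀ w, G.Adj v w → L i ∉ biSep D (X v w) := by
      by_contra! hcon
      let S : Finset (Fin N) := Finset.univ.filter fun i => (U i, L i) = β v
      let Q : Fin m → Finset (Fin N) := fun w => Finset.univ.filter fun i => L i ∈ biSep D (X v w)
      let Nb : Finset (Fin m) := Finset.univ.filter fun w => G.Adj v w
      have hS : S.card ≤ 1 := by
        rw [Finset.card_le_one]
        intro a ha b hb
        simp only [S, Finset.mem_filter, Finset.mem_univ, true_and] at ha hb
        have := ha.trans hb.symm
        simpa using this
      have hQ : ∀ w ∈ Nb, (Q w).card ≤ k := by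
        intro w hvw
        refine le_trans ?_ (hw v w (by simpa [Nb] using hvw))
        rw [← Set.ncard_coe_finset]
        apply Set.ncard_le_ncard_of_injOn L
        · intro i hi
          simpa [Q] using hi
        · intro a _ b _ hab
          simpa using hab
      have hNb : Nb.card ≤ 3 := by
        have := hdeg v
        rw [← Set.ncard_coe_finset]
        convert this using 2
        ext w
        simp [Nb]
      have hcov : (Finset.univ : Finset (Fin N)) ⊆ S ∪ Nb.biUnion Q := by
        intro i _
        simp only [Finset.mem_union, Finset.mem_biUnion, S, Q, Nb, Finset.mem_filter,
          Finset.mem_univ, true_and]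
        by_cases hiv : (U i, L i) = β v
        · exact Or.inl hiv
        · exact Or.inr (hcon i hiv)
      have h1 := (Finset.card_le_card hcov).trans (Finset.card_union_le _ _)
      have h2 := Finset.card_biUnion_le_card_mul Nb Q k hQ
      have h3 : Nb.card * k ≤ 3 * k := Nat.mul_le_mul_right k hNb
      simp only [Finset.card_univ, Fintype.card_fin] at h1
      omega
    obtain ⟨i, hiv, hi⟩ := hi
    obtain ⟨t, ht, hte⟩ := hβ.surjOn (show (U i, L i) ∈ D.edgeSet' from hUL i)
    have hvt : v ≠ t := by rintro rfl; exact hiv hte.symm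
    obtain ⟨w, hvw, htw⟩ := exists_mem_side G hT.connected v t hvt
    refine ⟨w, hvw, i, fun j => ?_⟩
    by_contra hj
    refine hi w hvw (Or.inr ⟨U i, B j, hUL i, ?_, hLB i j, hLB i j, hj⟩)
    exact fun hh => hh.2 ⟨t, ⟨ht, htw⟩, hte⟩
  choose f hf hfX using hbig
  obtain ⟨v, hv⟩ := exists_two_cycle G hT f hf
  obtain ⟨i, hi⟩ := hfX v
  obtain ⟨i', hi'⟩ := hfX (f v)
  rw [hv] at hi'
  have hdisj : ∀ e, e ∈ X v (f v) → e ∈ X (f v) v → False := by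
    rintro e ⟨s, ⟨hs, hs'⟩, rfl⟩ ⟨t, ⟨ht, ht'⟩, hst⟩
    have := hβ.injOn ht hs hst
    subst this
    exact side_disjoint G hT.isAcyclic _ _ _ (hf v) hs' ht'
  have hj : ∃ j, B j ∉ biSep D (X v (f v)) := by
    by_contra! hcon
    have h1 : (Set.univ : Set (Fin N)).ncard ≤ (biSep D (X v (f v))).ncard := by
      apply Set.ncard_le_ncard_of_injOn B
      · intro i _
        exact hcon i
      · intro a _ b _ hab
        simpa using hab
    have h2 := hw v (f v) (hf v)
    simp only [Set.ncard_univ, Nat.card_eq_fintype_card, Fintype.card_fin] at h1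
    have h3 := h1.trans h2
    omega
  obtain ⟨j, hj⟩ := hj
  apply hj
  by_cases hc : (B j, C j) ∈ X v (f v)
  · exact Or.inl ⟨L i', C j, hLB i' j, fun hh => hdisj _ hh (hi' j), hBC j, hc⟩
  · exact Or.inr ⟨L i, C j, hLB i j, fun hh => hh.2 (hi j), hBC j, hBC j, hc⟩

lemma exH_edges (N : ℕ) (hN : 2 ≤ N) :
    2 ≤ (exD (Finset.univ : Finset (Fin N)) Finset.univ).edgeSet'.ncard := by
  have h1 : (Set.univ : Set (Fin N)).ncard ≤
      (exD (Finset.univ : Finset (Fin N)) Finset.univ).edgeSet'.ncard := by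
    apply Set.ncard_le_ncard_of_injOn (fun i => (U i, L i))
    · intro i _
      simp [Digraph.edgeSet', exD, exAdj]
    · intro a _ b _ hab
      simpa using hab
  simp only [Set.ncard_univ, Nat.card_eq_fintype_card, Fintype.card_fin] at h1
  omega

lemma exFamily (n : ℕ) : ∃ (V : Type) (_ : Fintype V) (J H : Digraph V),
    DirTopMinor H J ∧ dbw J ≤ 3 ∧ n ≤ dbw H := by
  refine ⟨Vx (3 * n + 2), inferInstance, exD ∅ ∅, exD Finset.univ Finset.univ, exMinor _,
    by rw [dbw_exJ]; omega, ?_⟩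
  have hne : {k | dbwLE (exD (Finset.univ : Finset (Fin (3 * n + 2))) Finset.univ) k}.Nonempty :=
    exists_dbwLE _ (exH_edges _ (by omega))
  have h := exH_lower _ _ (Nat.sInf_mem hne)
  change 3 * n + 2 ≤ 3 * dbw _ + 1 at h
  omega

/-- There is no function `g : ℕ → ℕ` such that `dbw(H) ≤ g(dbw(J))` for
every directed topological minor `H` of a digraph `J`; in particular, there are digraphs
of directed branch-width at most `3` having directed topological minors of arbitrarily
large directed branch-width. -/
theorem no_function_bounding_dbw_of_dirTopMinor :
    (¬∃ g : ℕ → ℕ, ∀ (V : Type) (_ : Fintype V) (J H : Digraph V),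
        DirTopMinor H J → dbw H ≤ g (dbw J)) ∧
    (∀ n : ℕ, ∃ (V : Type) (_ : Fintype V) (J H : Digraph V),
        DirTopMinor H J ∧ dbw J ≤ 3 ∧ n ≤ dbw H) := by

  refine ⟨?_, exFamily⟩
  rintro ⟨g, hg⟩
  obtain ⟨V, hV, J, H, hm, hJ, hH⟩ := exFamily (g 0 + g 1 + g 2 + g 3 + 1)
  have h := hg V hV J H hm
  generalize dbw J = a at *
  interval_cases a <;> omega
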